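/- arXiv:1701.07478 — 10 statements merged into one kernel-verified Lean document; each statement's English description precedes it below -/
import Mathlib

section
/- Let n ≥ 1 and let p, q : Fin n → ℝ be probability vectors with strictly positive entries. Define g : ℝ → ℝ by g(α) := (α − 1)⁻¹ · Real.log (Σ_i (p i)^α · (q i)^(1−α)). Then g has derivative at α = 0 equal to the relative entropy D(q‖p) := Σ_i q i · Real.log (q i / p i); that is, HasDerivAt g (D(q‖p)) 0 (in particular g(0) = 0 since q is normalized). -/
theorem renyi_derivative_at_zero (n : ℕ) (hn : 1 ≤ n) (p q : Fin n → ℝ)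
    (hp : ∀ i, 0 < p i) (hq : ∀ i, 0 < q i)
    (hpsum : ∑ i, p i = 1) (hqsum : ∑ i, q i = 1) :
    HasDerivAt (fun α : ℝ => (α - 1)⁻¹ * Real.log (∑ i, p i ^ α * q i ^ (1 - α)))
      (∑ i, q i * Real.log (q i / p i)) 0 := by
  have hterm : ∀ i, HasDerivAt (fun α : ℝ => p i ^ α * q i ^ (1 - α))
      (-(q i * Real.log (q i / p i))) 0 := fun i => by
    have hpi := (hasDerivAt_id (0 : ℝ)).const_rpow (hp i)
    have hqi := ((hasDerivAt_id (0 : ℝ)).const_sub 1).const_rpow (hq i)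
    refine (hpi.mul hqi).congr_deriv ?_
    rw [Real.log_div (hq i).ne' (hp i).ne']
    simp
    ring
  have hsum : HasDerivAt (fun α : ℝ => ∑ i, p i ^ α * q i ^ (1 - α))
      (∑ i, -(q i * Real.log (q i / p i))) 0 := HasDerivAt.fun_sum fun i _ => hterm i
  have hlog := hsum.log (by simp [hqsum])
  have hinv := ((hasDerivAt_id (0 : ℝ)).sub_const 1).fun_inv (by simp)
  refine (hinv.mul hlog).congr_deriv ?_
  simp [hqsum]
end

section
/- Let n ≥ 1 and let p, p', w : Fin n → ℝ be probability vectors with strictly positive entries. If S_α(p‖w) ≥ S_α(p'‖w) for every α ∈ (0, 2], then D(w‖p) ≥ D(w‖p'). (This is the classical core of the statement that the vacancy V_β(ρ, H) := S(ω_β(H)‖ρ) is a monotone under catalytic thermal operations: the Renyi-divergence conditions for 0 < α ≤ 2 imply monotonicity of the reversed relative entropy.) -/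
/-- The derivative at `α = 0` of `∑ i, p i ^ α * w i ^ (1 - α)` is minus the relative entropy of
`w` with respect to `p`. -/
theorem hasDerivAt_sum_rpow_mul_rpow_zero {ι : Type*} [Fintype ι] {p w : ι → ℝ}
    (hp : ∀ i, 0 < p i) (hw : ∀ i, 0 < w i) :
    HasDerivAt (fun α : ℝ => ∑ i, p i ^ α * w i ^ (1 - α))
      (-∑ i, w i * Real.log (w i / p i)) 0 := by
  rw [← Finset.sum_neg_distrib]
  refine HasDerivAt.fun_sum fun i _ => ?_
  have h₁ := (hasDerivAt_id (0 : ℝ)).const_rpow (hp i)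
  have h₂ := ((hasDerivAt_id (0 : ℝ)).const_sub 1).const_rpow (hw i)
  refine (h₁.mul h₂).congr_deriv ?_
  rw [Real.log_div (hw i).ne' (hp i).ne']
  simp
  ring

theorem vacancy_monotone_from_renyi (n : ℕ) (hn : 1 ≤ n) (p p' w : Fin n → ℝ)
    (hp : ∀ i, 0 < p i) (hp' : ∀ i, 0 < p' i) (hw : ∀ i, 0 < w i)
    (hpsum : ∑ i, p i = 1) (hp'sum : ∑ i, p' i = 1) (hwsum : ∑ i, w i = 1)
    (h : ∀ α ∈ Set.Ioc (0:ℝ) 2,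
      (α - 1)⁻¹ * Real.log (∑ i, p i ^ α * w i ^ (1 - α)) ≥
        (α - 1)⁻¹ * Real.log (∑ i, p' i ^ α * w i ^ (1 - α))) :
    ∑ i, w i * Real.log (w i / p i) ≥ ∑ i, w i * Real.log (w i / p' i) := by
  have hpos : ∀ q : Fin n → ℝ, (∀ i, 0 < q i) → ∀ α : ℝ,
      0 < ∑ i, q i ^ α * w i ^ (1 - α) := fun q hq α =>
    Finset.sum_pos (fun i _ => mul_pos (Real.rpow_pos_of_pos (hq i) _)
      (Real.rpow_pos_of_pos (hw i) _)) ⟨⟨0, hn⟩, Finset.mem_univ _⟩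
  have hd := (hasDerivAt_sum_rpow_mul_rpow_zero hp' hw).sub
    (hasDerivAt_sum_rpow_mul_rpow_zero hp hw)
  have hnonneg := ge_of_tendsto (b := 0) hd.tendsto_slope_zero_right (by
    filter_upwards [Ioo_mem_nhdsGT (zero_lt_one (α := ℝ))] with α hα
    have hle : ∑ i, p i ^ α * w i ^ (1 - α) ≤ ∑ i, p' i ^ α * w i ^ (1 - α) := by
      rw [← Real.log_le_log_iff (hpos p hp α) (hpos p' hp' α)]
      exact (mul_le_mul_left_of_neg (inv_lt_zero.2 (sub_neg.2 hα.2))).1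
        (h α ⟨hα.1, hα.2.le.trans one_le_two⟩)
    have hα0 : 0 ≤ α⁻¹ := inv_nonneg.2 hα.1.le
    simpa using mul_nonneg hα0 (sub_nonneg.2 hle))
  linarith
end

section
/- Let n ≥ 1, E : Fin n → ℝ with E i ≥ 0 for all i and E i₀ = 0 for some i₀, and let β_S > β be reals. Then the function α ↦ (α − 1)⁻¹ · Real.log (Σ_i (ω β_S i)^α · (ω β i)^(1−α)) tends, as α → +∞ (Filter.atTop), to Real.log (Z β) − Real.log (Z β_S); moreover Real.log (Z β) − Real.log (Z β_S) ≤ Real.log (Z β). -/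
/-- The exponential growth rate of `s ↦ ∑ i, w i * r i ^ s` is the logarithm of the largest base. -/
theorem tendsto_inv_mul_log_sum_mul_rpow {ι : Type*} [Fintype ι] {w r : ι → ℝ}
    (hw : ∀ i, 0 < w i) (hr : ∀ i, 0 < r i) {i₀ : ι} (hmax : ∀ i, r i ≤ r i₀) :
    Filter.Tendsto (fun s : ℝ => s⁻¹ * Real.log (∑ i, w i * r i ^ s))
      Filter.atTop (nhds (Real.log (r i₀))) := by
  have hlim (c : ℝ) : Filter.Tendsto (fun s : ℝ => s⁻¹ * c + Real.log (r i₀))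
      Filter.atTop (nhds (Real.log (r i₀))) := by
    simpa using (tendsto_inv_atTop_zero.mul_const c).add_const (Real.log (r i₀))
  have hlog {c s : ℝ} (hc : 0 < c) (hs : 0 < s) :
      s⁻¹ * Real.log (c * r i₀ ^ s) = s⁻¹ * Real.log c + Real.log (r i₀) := by
    rw [Real.log_mul hc.ne' (Real.rpow_pos_of_pos (hr i₀) s).ne', Real.log_rpow (hr i₀)]
    field_simp
  have hterm (s : ℝ) (i : ι) : 0 < w i * r i ^ s :=
    mul_pos (hw i) (Real.rpow_pos_of_pos (hr i) s)
  have hlower (s : ℝ) : w i₀ * r i₀ ^ s ≤ ∑ i, w i * r i ^ s :=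
    Finset.single_le_sum (f := fun i => w i * r i ^ s) (fun i _ => (hterm s i).le)
      (Finset.mem_univ i₀)
  refine tendsto_of_tendsto_of_tendsto_of_le_of_le' (hlim (Real.log (w i₀)))
    (hlim (Real.log (∑ i, w i))) ?_ ?_
  · filter_upwards [Filter.eventually_gt_atTop 0] with s hs
    rw [← hlog (hw i₀) hs]
    exact mul_le_mul_of_nonneg_left (Real.log_le_log (hterm s i₀) (hlower s)) (inv_pos.2 hs).le
  · filter_upwards [Filter.eventually_gt_atTop 0] with s hs
    rw [← hlog (Finset.sum_pos (fun i _ => hw i) ⟨i₀, Finset.mem_univ i₀⟩) hs]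
    refine mul_le_mul_of_nonneg_left (Real.log_le_log ((hterm s i₀).trans_le (hlower s)) ?_)
      (inv_pos.2 hs).le
    rw [Finset.sum_mul]
    exact Finset.sum_le_sum fun i _ => mul_le_mul_of_nonneg_left
      (Real.rpow_le_rpow (hr i).le (hmax i) hs.le) (hw i).le

theorem rpow_mul_rpow_one_sub {p q : ℝ} (hp : 0 < p) (hq : 0 < q) (α : ℝ) :
    p ^ α * q ^ (1 - α) = p * (p / q) ^ (α - 1) := by
  rw [Real.div_rpow hp.le hq.le, Real.rpow_sub_one hp.ne', ← neg_sub α 1, Real.rpow_neg hq.le]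
  field_simp

theorem renyi_limit_at_top (n : ℕ) (hn : 1 ≤ n) (E : Fin n → ℝ)
    (hE : ∀ i, 0 ≤ E i) (i₀ : Fin n) (hE0 : E i₀ = 0)
    (β βS : ℝ) (hβ : β < βS) :
    Filter.Tendsto
      (fun α : ℝ => (α - 1)⁻¹ * Real.log (∑ i,
        (Real.exp (-βS * E i) / ∑ j, Real.exp (-βS * E j)) ^ α *
        (Real.exp (-β * E i) / ∑ j, Real.exp (-β * E j)) ^ (1 - α)))
      Filter.atTop
      (nhds (Real.log (∑ i, Real.exp (-β * E i)) -
        Real.log (∑ i, Real.exp (-βS * E i)))) ∧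
    Real.log (∑ i, Real.exp (-β * E i)) - Real.log (∑ i, Real.exp (-βS * E i)) ≤
      Real.log (∑ i, Real.exp (-β * E i)) := by
  have hZ1 (t : ℝ) : 1 ≤ ∑ i, Real.exp (-t * E i) := by
    simpa [hE0] using Finset.single_le_sum (f := fun i => Real.exp (-t * E i))
      (fun i _ => (Real.exp_pos _).le) (Finset.mem_univ i₀)
  have hZ (t : ℝ) : 0 < ∑ i, Real.exp (-t * E i) := zero_lt_one.trans_le (hZ1 t)
  have hω (t : ℝ) (i : Fin n) : 0 < Real.exp (-t * E i) / ∑ j, Real.exp (-t * E j) :=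
    div_pos (Real.exp_pos _) (hZ t)
  refine ⟨?_, sub_le_self _ (Real.log_nonneg (hZ1 βS))⟩
  simp only [rpow_mul_rpow_one_sub (hω βS _) (hω β _)]
  have hratio (i : Fin n) : (Real.exp (-βS * E i) / ∑ j, Real.exp (-βS * E j)) /
      (Real.exp (-β * E i) / ∑ j, Real.exp (-β * E j)) =
      Real.exp (-(βS - β) * E i) *
        ((∑ j, Real.exp (-β * E j)) / ∑ j, Real.exp (-βS * E j)) := by
    rw [div_div_div_comm, ← Real.exp_sub, div_eq_mul_inv, inv_div]
    ring_nf
  have hmax (i : Fin n) : (Real.exp (-βS * E i) / ∑ j, Real.exp (-βS * E j)) /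
      (Real.exp (-β * E i) / ∑ j, Real.exp (-β * E j)) ≤
      (Real.exp (-βS * E i₀) / ∑ j, Real.exp (-βS * E j)) /
      (Real.exp (-β * E i₀) / ∑ j, Real.exp (-β * E j)) := by
    rw [hratio, hratio, hE0]
    refine mul_le_mul_of_nonneg_right (Real.exp_le_exp.2 ?_) (div_pos (hZ β) (hZ βS)).le
    nlinarith [mul_nonneg (sub_pos.2 hβ).le (hE i)]
  have hlim := (tendsto_inv_mul_log_sum_mul_rpow (hω βS)
    (fun i => div_pos (hω βS i) (hω β i)) hmax).comp
    (Filter.tendsto_atTop_add_const_right Filter.atTop (-1 : ℝ) Filter.tendsto_id)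
  rw [hratio i₀, hE0, mul_zero, Real.exp_zero, one_mul,
    Real.log_div (hZ β).ne' (hZ βS).ne'] at hlim
  exact hlim
end

section
/- Concavity at low temperatures: Let n ≥ 2, β > 0, and E : Fin n → ℝ with E i ≥ 0 for all i, E i₀ = 0 for some i₀, and E not constant. For β_S > 0 set V(β_S) := Σ_i ω β i · Real.log (ω β i / ω β_S i) and δ(β_S) := Real.log (Z β) / V(β_S), and let F_{β_S} : ℝ → ℝ be F_{β_S}(α) := (α − 1)⁻¹ · Real.log (Σ_i (ω β_S i)^α · (ω β i)^(1−α)). Then there exists β_cr > 0 such that for every β_S > β_cr: V(β_S) > 0, δ(β_S) < 1, and for all α with 0 < α < δ(β_S) the second derivative satisfies iteratedDeriv 2 F_{β_S} α ≤ 0. -/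
/-- Partition function of energies `E` at inverse temperature `t`. -/
noncomputable def Zf {n : ℕ} (E : Fin n → ℝ) (t : ℝ) : ℝ := ∑ i, Real.exp (-t * E i)

/-- Gibbs distribution of energies `E` at inverse temperature `t`. -/
noncomputable def gibbs {n : ℕ} (E : Fin n → ℝ) (t : ℝ) (i : Fin n) : ℝ :=
  Real.exp (-t * E i) / Zf E t

open Filter Topology

/-- Moment sums `∑ i, E i ^ k * exp (-t * E i)`. -/
noncomputable def gibbsMoment {n : ℕ} (E : Fin n → ℝ) (k : ℕ) (t : ℝ) : ℝ :=
  ∑ i, E i ^ k * Real.exp (-t * E i)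

lemma Zf_eq_gibbsMoment {n : ℕ} (E : Fin n → ℝ) (t : ℝ) : Zf E t = gibbsMoment E 0 t := by
  simp [Zf, gibbsMoment]

lemma hasDerivAt_gibbsMoment {n : ℕ} (E : Fin n → ℝ) (k : ℕ) (t : ℝ) :
    HasDerivAt (gibbsMoment E k) (-gibbsMoment E (k + 1) t) t := by
  unfold gibbsMoment
  rw [← Finset.sum_neg_distrib]
  refine HasDerivAt.fun_sum fun i _ => ?_
  have h : HasDerivAt (fun x : ℝ => -x * E i) (-1 * E i) t :=
    (hasDerivAt_id t).neg.mul_const (E i)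
  refine (h.exp.const_mul (E i ^ k)).congr_deriv ?_
  ring

lemma one_le_Zf {n : ℕ} {E : Fin n → ℝ} {i₀ : Fin n} (hE0 : E i₀ = 0) (t : ℝ) :
    1 ≤ Zf E t := by
  have h := Finset.single_le_sum (f := fun i => Real.exp (-t * E i))
    (fun i _ => (Real.exp_pos _).le) (Finset.mem_univ i₀)
  simpa [hE0, Zf] using h

lemma Zf_anti {n : ℕ} {E : Fin n → ℝ} (hE : ∀ i, 0 ≤ E i) : Antitone (Zf E) := by
  intro s t hst
  refine Finset.sum_le_sum fun i _ => Real.exp_le_exp.2 ?_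
  nlinarith [mul_le_mul_of_nonneg_right hst (hE i)]

lemma gibbsMoment_one_le {n : ℕ} {E : Fin n → ℝ} (hE : ∀ i, 0 ≤ E i) (t : ℝ) :
    gibbsMoment E 1 t ≤ (∑ i, E i) * Zf E t := by
  unfold gibbsMoment
  rw [Finset.sum_mul]
  refine Finset.sum_le_sum fun i _ => ?_
  rw [pow_one]
  exact mul_le_mul_of_nonneg_left (Finset.single_le_sum
    (f := fun i => Real.exp (-t * E i)) (fun i _ => (Real.exp_pos _).le)
    (Finset.mem_univ i)) (hE i)

lemma le_gibbsMoment {n : ℕ} {E : Fin n → ℝ} (hE : ∀ i, 0 ≤ E i) (k : ℕ) (t : ℝ)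
    (j : Fin n) : E j ^ k * Real.exp (-t * E j) ≤ gibbsMoment E k t :=
  Finset.single_le_sum (f := fun i => E i ^ k * Real.exp (-t * E i))
    (fun i _ => mul_nonneg (pow_nonneg (hE i) k) (Real.exp_pos _).le) (Finset.mem_univ j)

/-- Cauchy–Schwarz with the zero-energy level removed. -/
lemma gibbsMoment_one_sq_le {n : ℕ} {E : Fin n → ℝ} {i₀ : Fin n} (hE0 : E i₀ = 0) (t : ℝ) :
    gibbsMoment E 1 t ^ 2 ≤ (Zf E t - 1) * gibbsMoment E 2 t := by
  have h0 : Zf E t - 1 = ∑ i ∈ Finset.univ.erase i₀, Real.exp (-t * E i) := by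
    rw [Zf, ← Finset.add_sum_erase _ _ (Finset.mem_univ i₀)]
    simp [hE0]
  have hk (k : ℕ) (hk : k ≠ 0) : gibbsMoment E k t =
      ∑ i ∈ Finset.univ.erase i₀, E i ^ k * Real.exp (-t * E i) := by
    rw [gibbsMoment, ← Finset.add_sum_erase _ _ (Finset.mem_univ i₀)]
    simp [hE0, hk]
  rw [h0, hk 1 one_ne_zero, hk 2 two_ne_zero]
  refine Finset.sum_sq_le_sum_mul_sum_of_sq_le_mul _ (fun i _ => (Real.exp_pos _).le)
    (fun i _ => mul_nonneg (sq_nonneg _) (Real.exp_pos _).le) fun i _ => le_of_eq ?_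
  ring

lemma hasDerivAt_log_Zf {n : ℕ} {E : Fin n → ℝ} {t : ℝ} (hZ : Zf E t ≠ 0) :
    HasDerivAt (fun x => Real.log (Zf E x)) (-(gibbsMoment E 1 t / Zf E t)) t := by
  have h := hasDerivAt_gibbsMoment E 0 t
  rw [← funext (Zf_eq_gibbsMoment E)] at h
  exact (h.log hZ).congr_deriv (by ring)

lemma hasDerivAt_mean_energy {n : ℕ} {E : Fin n → ℝ} {t : ℝ} (hZ : Zf E t ≠ 0) :
    HasDerivAt (fun x => -(gibbsMoment E 1 x / Zf E x))
      (gibbsMoment E 2 t / Zf E t - (gibbsMoment E 1 t / Zf E t) ^ 2) t := by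
  have h := hasDerivAt_gibbsMoment E 0 t
  rw [← funext (Zf_eq_gibbsMoment E)] at h
  refine ((hasDerivAt_gibbsMoment E 1 t).div h hZ).neg.congr_deriv ?_
  field_simp
  ring

lemma log_gibbs {n : ℕ} {E : Fin n → ℝ} {t : ℝ} (hZ : Zf E t ≠ 0) (i : Fin n) :
    Real.log (gibbs E t i) = -t * E i - Real.log (Zf E t) := by
  rw [gibbs, Real.log_div (Real.exp_ne_zero _) hZ, Real.log_exp]

lemma gibbs_pos {n : ℕ} {E : Fin n → ℝ} {t : ℝ} (hZ : 0 < Zf E t) (i : Fin n) :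
    0 < gibbs E t i := div_pos (Real.exp_pos _) hZ

lemma sum_gibbs_mul_log_div {n : ℕ} {E : Fin n → ℝ} {s t : ℝ} (hs : 0 < Zf E s)
    (ht : 0 < Zf E t) :
    ∑ i, gibbs E s i * Real.log (gibbs E s i / gibbs E t i) =
      (t - s) * (gibbsMoment E 1 s / Zf E s) + Real.log (Zf E t) - Real.log (Zf E s) := by
  have h1 : ∑ i, gibbs E s i = 1 := by
    simp only [gibbs]
    rw [← Finset.sum_div]
    exact div_self hs.ne'
  have h2 : ∑ i, gibbs E s i * E i = gibbsMoment E 1 s / Zf E s := by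
    rw [gibbsMoment, Finset.sum_div]
    exact Finset.sum_congr rfl fun i _ => by rw [gibbs]; ring
  calc _ = ∑ i, ((t - s) * (gibbs E s i * E i)
        + gibbs E s i * (Real.log (Zf E t) - Real.log (Zf E s))) := by
        refine Finset.sum_congr rfl fun i _ => ?_
        rw [Real.log_div (gibbs_pos hs i).ne' (gibbs_pos ht i).ne', log_gibbs hs.ne',
          log_gibbs ht.ne']
        ring
    _ = _ := by
        rw [Finset.sum_add_distrib, ← Finset.mul_sum, ← Finset.sum_mul, h1, h2]
        ring

lemma log_sum_gibbs_rpow {n : ℕ} {E : Fin n → ℝ} {s t : ℝ} (hZ : ∀ x, 0 < Zf E x) (a : ℝ) :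
    Real.log (∑ i, gibbs E t i ^ a * gibbs E s i ^ (1 - a)) =
      Real.log (Zf E (s + (t - s) * a)) - a * Real.log (Zf E t)
        - (1 - a) * Real.log (Zf E s) := by
  have h : ∑ i, gibbs E t i ^ a * gibbs E s i ^ (1 - a) = Zf E (s + (t - s) * a) *
      Real.exp (-(a * Real.log (Zf E t)) - (1 - a) * Real.log (Zf E s)) := by
    rw [Zf, Finset.sum_mul]
    refine Finset.sum_congr rfl fun i _ => ?_
    rw [Real.rpow_def_of_pos (gibbs_pos (hZ t) i), Real.rpow_def_of_pos (gibbs_pos (hZ s) i),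
      log_gibbs (hZ t).ne', log_gibbs (hZ s).ne', ← Real.exp_add, ← Real.exp_add]
    congr 1
    ring
  rw [h, Real.log_mul (hZ _).ne' (Real.exp_ne_zero _), Real.log_exp]
  ring

lemma iteratedDeriv_two_inv_sub_one_mul {g g' : ℝ → ℝ} {g'' α : ℝ}
    (hg : ∀ a, HasDerivAt g (g' a) a) (hg' : HasDerivAt g' g'' α) (hα : α ≠ 1) :
    iteratedDeriv 2 (fun a => (a - 1)⁻¹ * g a) α =
      ((1 - α) ^ 2 * g'' + 2 * ((1 - α) * g' α + g α)) / (α - 1) ^ 3 := by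
  have hinv (a : ℝ) (ha : a ≠ 1) :
      HasDerivAt (fun x : ℝ => (x - 1)⁻¹) (-((a - 1)⁻¹ ^ 2)) a := by
    refine (((hasDerivAt_id a).sub_const 1).fun_inv (sub_ne_zero.2 ha)).congr_deriv ?_
    simp [div_eq_mul_inv]
  have h1 : deriv (fun a => (a - 1)⁻¹ * g a) =ᶠ[𝓝 α]
      fun a => -((a - 1)⁻¹ ^ 2) * g a + (a - 1)⁻¹ * g' a := by
    filter_upwards [isOpen_ne.mem_nhds hα] with a ha
    exact ((hinv a ha).mul (hg a)).deriv
  rw [iteratedDeriv_succ, iteratedDeriv_one, h1.deriv_eq]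
  have h2 := ((((hinv α hα).fun_pow 2).fun_neg.fun_mul (hg α)).fun_add
    ((hinv α hα).fun_mul hg')).deriv
  rw [h2]
  have := sub_ne_zero.2 hα
  simp only [Nat.cast_ofNat, Nat.add_one_sub_one, pow_one]
  field_simp
  ring

/-- A temperature-uniform lower bound for the energy variance. -/
lemma le_energy_variance {n : ℕ} {E : Fin n → ℝ} (hE : ∀ i, 0 ≤ E i) {i₀ : Fin n}
    (hE0 : E i₀ = 0) (j : Fin n) {s t T : ℝ} (hst : s ≤ t) (htT : t ≤ T) :
    E j ^ 2 * Real.exp (-T * E j) / Zf E s ^ 2 ≤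
      gibbsMoment E 2 t / Zf E t - (gibbsMoment E 1 t / Zf E t) ^ 2 := by
  have hZ : 0 < Zf E t := one_pos.trans_le (one_le_Zf hE0 t)
  have hexp : E j ^ 2 * Real.exp (-T * E j) ≤ gibbsMoment E 2 t := by
    refine le_trans ?_ (le_gibbsMoment hE 2 t j)
    have := mul_le_mul_of_nonneg_right htT (hE j)
    exact mul_le_mul_of_nonneg_left (Real.exp_le_exp.2 (by linarith)) (sq_nonneg _)
  have hvar : gibbsMoment E 2 t / Zf E t - (gibbsMoment E 1 t / Zf E t) ^ 2 =
      (Zf E t * gibbsMoment E 2 t - gibbsMoment E 1 t ^ 2) / Zf E t ^ 2 := by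
    field_simp
  rw [hvar]
  have hnum := gibbsMoment_one_sq_le hE0 t
  have := Zf_anti hE hst
  apply div_le_div₀ _ _ (by positivity) (by gcongr)
  · linarith [mul_nonneg (sq_nonneg (E j)) (Real.exp_pos (-T * E j)).le]
  · linarith

lemma iteratedDeriv_two_renyi_gibbs {n : ℕ} {E : Fin n → ℝ} {s t α : ℝ}
    (hZ : ∀ x, 0 < Zf E x) (hα : α ≠ 1) :
    iteratedDeriv 2
        (fun a : ℝ => (a - 1)⁻¹ * Real.log (∑ i, gibbs E t i ^ a * gibbs E s i ^ (1 - a))) α =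
      (((1 - α) * (t - s)) ^ 2 * (gibbsMoment E 2 (s + (t - s) * α) / Zf E (s + (t - s) * α)
          - (gibbsMoment E 1 (s + (t - s) * α) / Zf E (s + (t - s) * α)) ^ 2)
        + 2 * (Real.log (Zf E (s + (t - s) * α)) - Real.log (Zf E t)
          - (1 - α) * (t - s) * (gibbsMoment E 1 (s + (t - s) * α) / Zf E (s + (t - s) * α))))
        / (α - 1) ^ 3 := by
  simp_rw [log_sum_gibbs_rpow hZ]
  have hlin (a : ℝ) : HasDerivAt (fun x : ℝ => s + (t - s) * x) (t - s) a := by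
    simpa using ((hasDerivAt_id a).const_mul (t - s)).const_add s
  have hg (a : ℝ) : HasDerivAt (fun a => Real.log (Zf E (s + (t - s) * a))
      - a * Real.log (Zf E t) - (1 - a) * Real.log (Zf E s))
      (-(gibbsMoment E 1 (s + (t - s) * a) / Zf E (s + (t - s) * a)) * (t - s)
        - 1 * Real.log (Zf E t) - (-1) * Real.log (Zf E s)) a :=
    (((hasDerivAt_log_Zf (hZ _).ne').comp a (hlin a)).sub
      ((hasDerivAt_id a).mul_const _)).sub (((hasDerivAt_id a).const_sub 1).mul_const _)
  have hg' : HasDerivAt (fun a =>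
      -(gibbsMoment E 1 (s + (t - s) * a) / Zf E (s + (t - s) * a)) * (t - s)
        - 1 * Real.log (Zf E t) - (-1) * Real.log (Zf E s))
      ((gibbsMoment E 2 (s + (t - s) * α) / Zf E (s + (t - s) * α)
          - (gibbsMoment E 1 (s + (t - s) * α) / Zf E (s + (t - s) * α)) ^ 2) * (t - s)
          * (t - s)) α :=
    ((((hasDerivAt_mean_energy (hZ _).ne').comp α (hlin α)).mul_const (t - s)).sub_const
      _).sub_const _
  rw [iteratedDeriv_two_inv_sub_one_mul hg hg' hα]
  congr 1
  ring

theorem concavity_at_low_temperatures (n : ℕ) (hn : 2 ≤ n) (β : ℝ) (hβ : 0 < β)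
    (E : Fin n → ℝ) (hE : ∀ i, 0 ≤ E i) (i₀ : Fin n) (hE0 : E i₀ = 0)
    (hnonconst : ∃ i j, E i ≠ E j) :
    ∃ βcr > (0:ℝ), ∀ βS > βcr,
      (0 < ∑ i, gibbs E β i * Real.log (gibbs E β i / gibbs E βS i)) ∧
      Real.log (Zf E β) / (∑ i, gibbs E β i * Real.log (gibbs E β i / gibbs E βS i)) < 1 ∧
      ∀ α : ℝ, 0 < α →
        α < Real.log (Zf E β) /
              (∑ i, gibbs E β i * Real.log (gibbs E β i / gibbs E βS i)) →
        iteratedDeriv 2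
          (fun a : ℝ =>
            (a - 1)⁻¹ * Real.log (∑ i, gibbs E βS i ^ a * gibbs E β i ^ (1 - a))) α ≤ 0 := by
  have hZ1 := one_le_Zf hE0
  have hZ (x : ℝ) : 0 < Zf E x := one_pos.trans_le (hZ1 x)
  obtain ⟨j, hj⟩ : ∃ j, 0 < E j := by
    by_contra! h
    obtain ⟨i, j, hij⟩ := hnonconst
    exact hij (((h i).antisymm (hE i)).trans ((h j).antisymm (hE j)).symm)
  set L := Real.log (Zf E β)
  have hL : 0 ≤ L := Real.log_nonneg (hZ1 β)
  set U := gibbsMoment E 1 β / Zf E β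
  have hU : 0 < U :=
    div_pos ((by positivity : 0 < E j ^ 1 * Real.exp (-β * E j)).trans_le
      (le_gibbsMoment hE 1 β j)) (hZ β)
  set K := 2 * L / U
  have hK : 0 ≤ K := by positivity
  have hKU : K * U = 2 * L := div_mul_cancel₀ _ hU.ne'
  set c := E j ^ 2 * Real.exp (-(β + K) * E j) / Zf E β ^ 2
  have hc : 0 < c := div_pos (by positivity) (pow_pos (hZ β) 2)
  set M := ∑ i, E i
  have hM : 0 ≤ M := Finset.sum_nonneg fun i _ => hE i
  have hMc : 0 ≤ 2 * M / c := by positivity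
  refine ⟨β + K + 2 * M / c, by positivity, fun βS hβS => ?_⟩
  rw [sum_gibbs_mul_log_div (hZ β) (hZ βS)]
  have hLS : 0 ≤ Real.log (Zf E βS) := Real.log_nonneg (hZ1 βS)
  have hs : K < βS - β := by linarith
  have hsU : 2 * L < (βS - β) * U := hKU ▸ mul_lt_mul_of_pos_right hs hU
  have hV : (βS - β) * U / 2 < (βS - β) * U + Real.log (Zf E βS) - L := by linarith
  have hVpos : 0 < (βS - β) * U + Real.log (Zf E βS) - L := by linarith
  have hδ : L / ((βS - β) * U + Real.log (Zf E βS) - L) < 1 := by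
    rw [div_lt_one hVpos]
    linarith
  refine ⟨hVpos, hδ, fun α hα hαδ => ?_⟩
  have hα1 : α < 1 := hαδ.trans hδ
  have hsα : (βS - β) * α ≤ K := by
    rw [lt_div_iff₀ hVpos] at hαδ
    rw [le_div_iff₀ hU]
    nlinarith [mul_lt_mul_of_pos_left hV hα]
  rw [iteratedDeriv_two_renyi_gibbs hZ hα1.ne]
  have hsα0 : 0 ≤ (βS - β) * α := mul_nonneg (by linarith) hα.le
  set t := β + (βS - β) * α with ht
  have hvar := le_energy_variance hE hE0 j (by linarith : β ≤ t) (by linarith : t ≤ β + K)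
  have hmean : gibbsMoment E 1 t / Zf E t ≤ M :=
    (div_le_iff₀ (hZ t)).2 (gibbsMoment_one_le hE t)
  have hx : (1 - α) * (βS - β) = βS - t := by rw [ht]; ring
  rw [hx]
  have hxc : 2 * M / c ≤ βS - t := by linarith
  have hlog : Real.log (Zf E βS) ≤ Real.log (Zf E t) :=
    Real.log_le_log (hZ βS) (Zf_anti hE (by linarith))
  refine div_nonpos_of_nonneg_of_nonpos ?_
    (Odd.pow_nonpos (by decide) (by linarith))
  have hx0 : 0 ≤ βS - t := hMc.trans hxc
  have h1 := mul_le_mul_of_nonneg_left hvar (sq_nonneg (βS - t))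
  have h2 := mul_le_mul_of_nonneg_left hmean hx0
  have h3 := mul_le_mul_of_nonneg_left ((div_le_iff₀ hc).1 hxc) hx0
  linarith
end

section
/- Renyi divergence between thermal states: Let n ≥ 1, E : Fin n → ℝ, and β_R, β, α : ℝ with α ≠ 1. Then (α − 1)⁻¹ · Real.log (Σ_i (ω β_R i)^α · (ω β i)^(1−α)) = Real.log (Z β / Z β_R) + (α − 1)⁻¹ · Real.log (Z ((β_R − β) · α + β) / Z β_R). -/
theorem Zf_pos {n : ℕ} [NeZero n] (E : Fin n → ℝ) (t : ℝ) : 0 < Zf E t :=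
  Finset.sum_pos (fun _ _ => Real.exp_pos _) Finset.univ_nonempty

theorem gibbs_rpow {n : ℕ} [NeZero n] (E : Fin n → ℝ) (t p : ℝ) (i : Fin n) :
    gibbs E t i ^ p = Real.exp (-t * E i * p) / Zf E t ^ p := by
  rw [gibbs, Real.div_rpow (Real.exp_pos _).le (Zf_pos E t).le, ← Real.exp_mul]

theorem sum_gibbs_rpow_mul_gibbs_rpow {n : ℕ} [NeZero n] (E : Fin n → ℝ) (s t p : ℝ) :
    ∑ i, gibbs E s i ^ p * gibbs E t i ^ (1 - p) =
      Zf E ((s - t) * p + t) / (Zf E s ^ p * Zf E t ^ (1 - p)) := by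
  rw [Zf, Finset.sum_div]
  refine Finset.sum_congr rfl fun i _ => ?_
  rw [gibbs_rpow, gibbs_rpow, div_mul_div_comm, ← Real.exp_add]
  congr 2
  ring

theorem renyi_between_thermal_states (n : ℕ) (hn : 1 ≤ n) (E : Fin n → ℝ)
    (βR β α : ℝ) (hα : α ≠ 1) :
    (α - 1)⁻¹ * Real.log (∑ i, gibbs E βR i ^ α * gibbs E β i ^ (1 - α)) =
      Real.log (Zf E β / Zf E βR) +
        (α - 1)⁻¹ * Real.log (Zf E ((βR - β) * α + β) / Zf E βR) := by
  have : NeZero n := ⟨by lia⟩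
  have hZ (t : ℝ) : 0 < Zf E t := Zf_pos E t
  have hα' : α - 1 ≠ 0 := sub_ne_zero.mpr hα
  have hR := Real.rpow_pos_of_pos (hZ βR) α
  have hβ := Real.rpow_pos_of_pos (hZ β) (1 - α)
  rw [sum_gibbs_rpow_mul_gibbs_rpow, Real.log_div (hZ _).ne' (mul_pos hR hβ).ne',
    Real.log_mul hR.ne' hβ.ne', Real.log_rpow (hZ _), Real.log_rpow (hZ _),
    Real.log_div (hZ _).ne' (hZ _).ne', Real.log_div (hZ _).ne' (hZ _).ne']
  field_simp
  ring
end

section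
/- Equidistant levels (Lemma 4): Let Δ > 0 and M : ℕ, and take the equidistant spectrum E : Fin (M + 1) → ℝ, E i := (i : ℝ) · Δ. Then the thermal energy function t ↦ Eav t = Σ_i (i · Δ) · Real.exp (−t · i · Δ) / (Σ_j Real.exp (−t · j · Δ)) is convex on Set.Ioi (0 : ℝ). -/
/-- Thermal average energy. -/
noncomputable def Eav {n : ℕ} (E : Fin n → ℝ) (t : ℝ) : ℝ := ∑ i, E i * gibbs E t i

theorem monotoneOn_Ici_of_hasDerivAt_nonneg {f f' : ℝ → ℝ} (hf : ∀ x, HasDerivAt f (f' x) x)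
    (hf' : ∀ x, 0 < x → 0 ≤ f' x) : MonotoneOn f (Set.Ici 0) := by
  refine monotoneOn_of_deriv_nonneg (convex_Ici 0)
    (fun x _ => (hf x).continuousAt.continuousWithinAt)
    (fun x _ => (hf x).differentiableAt.differentiableWithinAt) fun x hx => ?_
  rw [interior_Ici] at hx
  rw [(hf x).deriv]
  exact hf' x hx

theorem Real.sinh_le_mul_cosh {x : ℝ} (hx : 0 ≤ x) : Real.sinh x ≤ x * Real.cosh x := by
  have h := monotoneOn_Ici_of_hasDerivAt_nonneg (f := fun x => x * Real.cosh x - Real.sinh x)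
    (f' := fun x => x * Real.sinh x)
    (fun x => by
      refine HasDerivAt.congr_deriv (((hasDerivAt_id x).mul (Real.hasDerivAt_cosh x)).sub (Real.hasDerivAt_sinh x)) ?_
      simp)
    (fun x hx => mul_nonneg hx.le (Real.sinh_nonneg_iff.2 hx.le))
    Set.self_mem_Ici hx hx
  simp at h
  exact h

/-- The hyperbolic Cusa–Huygens inequality. -/
theorem Real.three_mul_sinh_le {x : ℝ} (hx : 0 ≤ x) :
    3 * Real.sinh x ≤ x * (2 + Real.cosh x) := by
  have h := monotoneOn_Ici_of_hasDerivAt_nonneg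
    (f := fun x => x * (2 + Real.cosh x) - 3 * Real.sinh x)
    (f' := fun x => 2 - 2 * Real.cosh x + x * Real.sinh x)
    (fun x => by
      refine HasDerivAt.congr_deriv (((hasDerivAt_id x).mul ((Real.hasDerivAt_cosh x).const_add 2)).sub
        ((Real.hasDerivAt_sinh x).const_mul 3)) ?_
      simp
      ring)
    (fun x hx => by
      have hy : 0 ≤ x / 2 := by positivity
      have h1 := mul_nonneg (Real.sinh_nonneg_iff.2 hy) (sub_nonneg.2 (Real.sinh_le_mul_cosh hy))
      have hx2 : x = 2 * (x / 2) := by ring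
      have h2 := Real.cosh_two_mul (x / 2)
      have h3 := Real.sinh_two_mul (x / 2)
      have h4 := Real.cosh_sq (x / 2)
      rw [← hx2] at h2 h3
      rw [h2, h3]
      nlinarith)
    Set.self_mem_Ici hx hx
  simp at h
  exact h

theorem antitoneOn_cube_mul_cosh_div_sinh_cube :
    AntitoneOn (fun x => x ^ 3 * (Real.cosh x / Real.sinh x ^ 3)) (Set.Ioi 0) := by
  have hd : ∀ x : ℝ, 0 < x → HasDerivAt (fun x => x ^ 3 * (Real.cosh x / Real.sinh x ^ 3))
      (x ^ 2 * (3 * Real.sinh x * Real.cosh x + x * Real.sinh x ^ 2 - 3 * x * Real.cosh x ^ 2)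
        / Real.sinh x ^ 4) x := by
    intro x hx
    have hs : Real.sinh x ≠ 0 := (Real.sinh_pos_iff.2 hx).ne'
    refine HasDerivAt.congr_deriv ((hasDerivAt_pow 3 x).mul ((Real.hasDerivAt_cosh x).div
      ((Real.hasDerivAt_sinh x).pow 3) (pow_ne_zero 3 hs))) ?_
    simp
    field_simp
    ring
  refine antitoneOn_of_deriv_nonpos (convex_Ioi 0)
    (fun x hx => (hd x hx).continuousAt.continuousWithinAt) ?_ ?_ <;> rw [interior_Ioi]
  · exact fun x hx => (hd x hx).differentiableAt.differentiableWithinAt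
  · intro x hx
    have hx0 : 0 < x := hx
    rw [(hd x hx).deriv]
    refine div_nonpos_of_nonpos_of_nonneg (mul_nonpos_of_nonneg_of_nonpos (by positivity) ?_)
      (by positivity)
    have h := Real.three_mul_sinh_le (x := 2 * x) (by positivity)
    rw [Real.cosh_two_mul, Real.sinh_two_mul] at h
    have h4 := Real.cosh_sq x
    rw [h4] at h ⊢
    nlinarith

theorem hasDerivAt_coth {x : ℝ} (hx : 0 < x) :
    HasDerivAt (fun x => Real.cosh x / Real.sinh x) (-(1 / Real.sinh x ^ 2)) x := by
  have hs : Real.sinh x ≠ 0 := (Real.sinh_pos_iff.2 hx).ne'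
  refine HasDerivAt.congr_deriv ((Real.hasDerivAt_cosh x).div (Real.hasDerivAt_sinh x) hs) ?_
  have h4 := Real.cosh_sq x
  field_simp
  linarith

theorem hasDerivAt_neg_one_div_sinh_sq {x : ℝ} (hx : 0 < x) :
    HasDerivAt (fun x => -(1 / Real.sinh x ^ 2)) (2 * (Real.cosh x / Real.sinh x ^ 3)) x := by
  have hs : Real.sinh x ≠ 0 := (Real.sinh_pos_iff.2 hx).ne'
  refine HasDerivAt.congr_deriv (((hasDerivAt_const x (1 : ℝ)).div ((Real.hasDerivAt_sinh x).pow 2)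
    (pow_ne_zero 2 hs)).neg) ?_
  simp
  field_simp

theorem convexOn_coth_sub_mul_coth {a : ℝ} (ha : 1 ≤ a) :
    ConvexOn ℝ (Set.Ioi 0)
      (fun x => Real.cosh x / Real.sinh x - a * (Real.cosh (a * x) / Real.sinh (a * x))) := by
  have ha0 : 0 < a := by linarith
  have hlin : ∀ x : ℝ, HasDerivAt (fun x => a * x) a x := fun x => by
    simpa using (hasDerivAt_id x).const_mul a
  refine convexOn_of_hasDerivWithinAt2_nonneg (convex_Ioi 0)
    (f' := fun x => -(1 / Real.sinh x ^ 2) - a * (-(1 / Real.sinh (a * x) ^ 2) * a))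
    (f'' := fun x => 2 * (Real.cosh x / Real.sinh x ^ 3)
      - a * (2 * (Real.cosh (a * x) / Real.sinh (a * x) ^ 3) * a * a)) ?_ ?_ ?_ ?_
  · intro x hx
    exact ((hasDerivAt_coth hx).sub (((hasDerivAt_coth (mul_pos ha0 hx)).comp x
      (hlin x)).const_mul a)).continuousAt.continuousWithinAt
  all_goals
    intro x hx
    rw [interior_Ioi] at hx
    have hx0 : 0 < x := hx
  · exact ((hasDerivAt_coth hx).sub (((hasDerivAt_coth (mul_pos ha0 hx)).comp x
      (hlin x)).const_mul a)).hasDerivWithinAt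
  · exact ((hasDerivAt_neg_one_div_sinh_sq hx).sub ((((hasDerivAt_neg_one_div_sinh_sq
      (mul_pos ha0 hx)).comp x (hlin x)).mul_const a).const_mul a)).hasDerivWithinAt
  · have h := antitoneOn_cube_mul_cosh_div_sinh_cube hx (mul_pos ha0 hx0)
      (le_mul_of_one_le_left hx0.le ha)
    have h3 : 0 < x ^ 3 := by positivity
    have := le_of_mul_le_mul_left (a := x ^ 3)
      (b := a ^ 3 * (Real.cosh (a * x) / Real.sinh (a * x) ^ 3))
      (c := Real.cosh x / Real.sinh x ^ 3) (by simp only [mul_pow] at h; linarith) h3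
    linarith

theorem sum_range_mul_pow_mul_one_sub_sq (r : ℝ) (N : ℕ) :
    (∑ i ∈ Finset.range N, (i : ℝ) * r ^ i) * (1 - r) ^ 2
      = r * (1 - r ^ N) - N * r ^ N * (1 - r) := by
  induction N with
  | zero => simp
  | succ k ih =>
    rw [Finset.sum_range_succ, add_mul, ih]
    push_cast
    ring

theorem Real.cosh_div_sinh_eq {x : ℝ} (hx : 0 < x) :
    Real.cosh x / Real.sinh x
      = (1 + Real.exp (-(2 * x))) / (1 - Real.exp (-(2 * x))) := by
  have h1 : Real.exp (-(2 * x)) < 1 := Real.exp_lt_one_iff.2 (by linarith)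
  rw [div_eq_div_iff (Real.sinh_pos_iff.2 hx).ne' (by linarith)]
  have h2 : Real.exp (-(2 * x)) = Real.exp (-x) ^ 2 := by
    rw [← Real.exp_nat_mul]; congr 1; push_cast; ring
  have h3 : Real.exp x * Real.exp (-x) = 1 := by rw [← Real.exp_add]; simp
  rw [Real.cosh_eq, Real.sinh_eq, h2]
  linear_combination (-Real.exp (-x)) * h3

theorem Eav_equidistant (Δ : ℝ) (hΔ : 0 < Δ) (M : ℕ) {t : ℝ} (ht : 0 < t) :
    Eav (fun i : Fin (M + 1) => (i : ℝ) * Δ) t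
      = Δ / 2 * ((Real.cosh (Δ / 2 * t) / Real.sinh (Δ / 2 * t)
        - ((M + 1 : ℕ) : ℝ) * (Real.cosh ((M + 1 : ℕ) * (Δ / 2 * t))
          / Real.sinh ((M + 1 : ℕ) * (Δ / 2 * t)))) + M) := by
  have hx : 0 < Δ / 2 * t := by positivity
  rw [Real.cosh_div_sinh_eq hx, Real.cosh_div_sinh_eq (by positivity)]
  set r := Real.exp (-(2 * (Δ / 2 * t))) with hr
  have hpow (k : ℕ) : Real.exp (-t * (k * Δ)) = r ^ k := by
    rw [hr, ← Real.exp_nat_mul]; congr 1; ring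
  have hN : Real.exp (-(2 * (((M + 1 : ℕ) : ℝ) * (Δ / 2 * t)))) = r ^ (M + 1) := by
    rw [← hpow]; congr 1; ring
  have hr0 : 0 < r := Real.exp_pos _
  have hr1 : r < 1 := Real.exp_lt_one_iff.2 (by linarith)
  have hrN : r ^ (M + 1) < 1 := pow_lt_one₀ hr0.le hr1 (by simp)
  have hZ : Zf (fun i : Fin (M + 1) => (i : ℝ) * Δ) t = (1 - r ^ (M + 1)) / (1 - r) := by
    rw [eq_div_iff (by linarith), ← geom_sum_mul_neg, Zf,
      ← Fin.sum_univ_eq_sum_range (fun i => r ^ i)]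
    simp only [hpow]
  have hS : ∑ i : Fin (M + 1), (i : ℝ) * r ^ (i : ℕ)
      = (r * (1 - r ^ (M + 1)) - (M + 1 : ℕ) * r ^ (M + 1) * (1 - r)) / (1 - r) ^ 2 := by
    rw [eq_div_iff (pow_ne_zero 2 (by linarith)), ← sum_range_mul_pow_mul_one_sub_sq,
      ← Fin.sum_univ_eq_sum_range (fun i => (i : ℝ) * r ^ i)]
  have hE : Eav (fun i : Fin (M + 1) => (i : ℝ) * Δ) t
      = Δ * (∑ i : Fin (M + 1), (i : ℝ) * r ^ (i : ℕ))
        / Zf (fun i : Fin (M + 1) => (i : ℝ) * Δ) t := by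
    simp only [Eav, gibbs, hpow, Finset.mul_sum, Finset.sum_div]
    exact Finset.sum_congr rfl fun i _ => by ring
  have h1 : 1 - r ≠ 0 := by linarith
  have h2 : 1 - r ^ (M + 1) ≠ 0 := by linarith
  rw [hE, hS, hZ, hN]
  generalize r ^ (M + 1) = q at *
  push_cast
  field_simp
  ring

theorem equidistant_levels_energy_convex (Δ : ℝ) (hΔ : 0 < Δ) (M : ℕ) :
    ConvexOn ℝ (Set.Ioi (0:ℝ))
      (fun t => Eav (fun i : Fin (M + 1) => (i : ℝ) * Δ) t) := by
  have hc := convexOn_coth_sub_mul_coth (a := ((M + 1 : ℕ) : ℝ)) (by simp)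
  have hpre : (LinearMap.mulLeft ℝ (Δ / 2)) ⁻¹' Set.Ioi 0 = Set.Ioi (0 : ℝ) := by
    ext t
    simp [hΔ]
  have h := ((hc.comp_linearMap (LinearMap.mulLeft ℝ (Δ / 2))).add_const (M : ℝ)).smul
    (c := Δ / 2) (by positivity)
  rw [hpre] at h
  exact h.congr fun t ht => (Eav_equidistant Δ hΔ M ht).symm
end

section
/- For every real x ≥ 0, one has x · (2 + Real.cosh x) − 3 · Real.sinh x ≥ 0; equivalently, 3 · Real.sinh x ≤ x · (2 + Real.cosh x). -/
theorem nonneg_of_hasDerivAt_nonneg {f f' : ℝ → ℝ} (h0 : f 0 = 0)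
    (hf : ∀ x, HasDerivAt f (f' x) x) (hf' : ∀ x, 0 ≤ x → 0 ≤ f' x) {x : ℝ} (hx : 0 ≤ x) :
    0 ≤ f x := by
  have hmono : MonotoneOn f (Set.Ici 0) := by
    refine monotoneOn_of_deriv_nonneg (convex_Ici 0)
      (fun y _ => (hf y).continuousAt.continuousWithinAt)
      (fun y _ => (hf y).differentiableAt.differentiableWithinAt) fun y hy => ?_
    rw [(hf y).deriv]
    exact hf' y (interior_subset hy)
  exact h0 ▸ hmono Set.self_mem_Ici hx hx

theorem self_mul_cosh_sub_sinh_nonneg {x : ℝ} (hx : 0 ≤ x) : 0 ≤ x * Real.cosh x - Real.sinh x := by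
  refine nonneg_of_hasDerivAt_nonneg (f := fun y => y * Real.cosh y - Real.sinh y)
    (f' := fun y => y * Real.sinh y) (by simp) (fun y => ?_)
    (fun y hy => mul_nonneg hy (Real.sinh_nonneg_iff.2 hy)) hx
  exact (((hasDerivAt_id' y).fun_mul (Real.hasDerivAt_cosh y)).fun_sub (Real.hasDerivAt_sinh y)).congr_deriv (by ring)

theorem self_mul_sinh_sub_two_mul_cosh_sub_one_nonneg {x : ℝ} (hx : 0 ≤ x) :
    0 ≤ x * Real.sinh x - 2 * (Real.cosh x - 1) := by
  refine nonneg_of_hasDerivAt_nonneg (f := fun y => y * Real.sinh y - 2 * (Real.cosh y - 1))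
    (f' := fun y => y * Real.cosh y - Real.sinh y) (by simp) (fun y => ?_)
    (fun y hy => self_mul_cosh_sub_sinh_nonneg hy) hx
  exact (((hasDerivAt_id' y).fun_mul (Real.hasDerivAt_sinh y)).fun_sub
    (((Real.hasDerivAt_cosh y).sub_const 1).const_mul 2)).congr_deriv (by ring)

theorem sinh_inequality (x : ℝ) (hx : 0 ≤ x) :
    0 ≤ x * (2 + Real.cosh x) - 3 * Real.sinh x := by
  refine nonneg_of_hasDerivAt_nonneg (f := fun y => y * (2 + Real.cosh y) - 3 * Real.sinh y)
    (f' := fun y => y * Real.sinh y - 2 * (Real.cosh y - 1)) (by simp) (fun y => ?_)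
    (fun y hy => self_mul_sinh_sub_two_mul_cosh_sub_one_nonneg hy) hx
  exact (((hasDerivAt_id' y).fun_mul ((Real.hasDerivAt_cosh y).const_add 2)).fun_sub
    ((Real.hasDerivAt_sinh y).const_mul 3)).congr_deriv (by ring)
end

section
/- Vacancy bound for a bounded work source: Let d ≥ 2 be a natural number, E ≥ 0 and β ≥ 0 reals, and e : Fin d → ℝ with −E/2 ≤ e j ≤ E/2 for all j and e j₀ = −E/2 for some j₀. Let Z := Σ_j Real.exp (−β · e j) and let w j := Real.exp (−β · e j) / Z be the Gibbs distribution. Then the relative entropy of w with respect to the uniform distribution u j := 1/d satisfies Σ_j w j · Real.log (w j / (1/d)) ≤ −Real.log (1/d + ((d − 1)/d) · Real.exp (−β · E)). In particular the vacancy of the maximally mixed work source is bounded by −log(1/d + ((d−1)/d)·e^{−βE}). -/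
/-- A sum that attains the value `M` once and is bounded below by `m` is at least `M + (d - 1) m`. -/
theorem Fin.add_pred_mul_le_sum {d : ℕ} {f : Fin d → ℝ} {m : ℝ} (hf : ∀ j, m ≤ f j)
    (j₀ : Fin d) : f j₀ + ((d : ℝ) - 1) * m ≤ ∑ j, f j := by
  have h := Finset.single_le_sum (f := fun j => f j - m) (s := Finset.univ)
    (fun j _ => sub_nonneg.2 (hf j)) (Finset.mem_univ j₀)
  simp only [Finset.sum_sub_distrib, Finset.sum_const, Finset.card_univ, Fintype.card_fin,
    nsmul_eq_mul] at h
  linarith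

theorem work_source_vacancy_bound (d : ℕ) (hd : 2 ≤ d) (E β : ℝ)
    (hE : 0 ≤ E) (hβ : 0 ≤ β) (e : Fin d → ℝ)
    (he : ∀ j, -E / 2 ≤ e j ∧ e j ≤ E / 2) (j₀ : Fin d) (hj₀ : e j₀ = -E / 2) :
    ∑ j, (Real.exp (-β * e j) / ∑ k, Real.exp (-β * e k)) *
        Real.log ((Real.exp (-β * e j) / ∑ k, Real.exp (-β * e k)) / (1 / (d : ℝ))) ≤
      -Real.log (1 / (d : ℝ) + (((d : ℝ) - 1) / (d : ℝ)) * Real.exp (-β * E)) := by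
  have hd' : (2 : ℝ) ≤ d := by exact_mod_cast hd
  have hd0 : (0 : ℝ) < d := by linarith
  have hsum := Fin.add_pred_mul_le_sum (f := fun j => Real.exp (-β * e j))
    (m := Real.exp (-β * e j₀) * Real.exp (-β * E)) (fun j => by
      rw [← Real.exp_add, Real.exp_le_exp, hj₀]
      nlinarith [mul_le_mul_of_nonneg_left (he j).2 hβ]) j₀
  have hmax : ∀ j, Real.exp (-β * e j) ≤ Real.exp (-β * e j₀) := fun j => by
    rw [Real.exp_le_exp, hj₀]
    nlinarith [mul_le_mul_of_nonneg_left (he j).1 hβ]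
  have hZ : 0 < ∑ k, Real.exp (-β * e k) :=
    Finset.sum_pos (fun k _ => Real.exp_pos _) ⟨j₀, Finset.mem_univ _⟩
  have hweights : ∑ j, Real.exp (-β * e j) / ∑ k, Real.exp (-β * e k) = 1 := by
    rw [← Finset.sum_div, div_self hZ.ne']
  set Z := ∑ k, Real.exp (-β * e k)
  set a := Real.exp (-β * E)
  have ha : 0 < a := Real.exp_pos _
  have hnum : 0 < 1 + ((d : ℝ) - 1) * a := by nlinarith
  have hB : 1 / (d : ℝ) + (((d : ℝ) - 1) / (d : ℝ)) * a = (1 + ((d : ℝ) - 1) * a) / d := by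
    ring
  rw [hB, ← Real.log_inv, inv_div]
  calc _ ≤ ∑ j, Real.exp (-β * e j) / Z * Real.log (d / (1 + ((d : ℝ) - 1) * a)) := by
        refine Finset.sum_le_sum fun j _ => mul_le_mul_of_nonneg_left ?_ (by positivity)
        refine Real.log_le_log (by positivity) ?_
        rw [div_div_eq_mul_div, div_one, le_div_iff₀ hnum, div_mul_eq_mul_div, div_mul_eq_mul_div,
          div_le_iff₀ hZ]
        have h := mul_le_mul_of_nonneg_right (hmax j) hnum.le
        have h' : Real.exp (-β * e j) * (1 + ((d : ℝ) - 1) * a) ≤ Z := by linarith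
        nlinarith [mul_le_mul_of_nonneg_left h' hd0.le]
    _ = _ := by rw [← Finset.sum_mul, hweights, one_mul]
end

section
/- Upper bound on f (appendix Lemma 7, classical version): Let n ≥ 1, β > 0, s : Fin n → ℝ a probability vector with s i > 0 for all i, and E : Fin n → ℝ with E i ≥ 0 for all i and E i₀ = 0 for some i₀. Then for every α ∈ Set.Icc (0 : ℝ) 1, Σ_i (s i)^α · Real.exp (−β · (E i) · (1 − α)) ≤ Σ_i Real.exp (−β · E i). -/
theorem f_upper_bound_by_partition_function (n : ℕ) (hn : 1 ≤ n) (β : ℝ) (hβ : 0 < β)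
    (s : Fin n → ℝ) (hs : ∀ i, 0 < s i) (hssum : ∑ i, s i = 1)
    (E : Fin n → ℝ) (hE : ∀ i, 0 ≤ E i) (i₀ : Fin n) (hE0 : E i₀ = 0) :
    ∀ α ∈ Set.Icc (0:ℝ) 1,
      ∑ i, s i ^ α * Real.exp (-β * E i * (1 - α)) ≤ ∑ i, Real.exp (-β * E i) := by
  rintro α ⟨h0, h1⟩
  have hZ : 1 ≤ ∑ i, Real.exp (-β * E i) := by
    simpa [hE0] using Finset.single_le_sum (f := fun i => Real.exp (-β * E i))
      (fun i _ => (Real.exp_pos _).le) (Finset.mem_univ i₀)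
  calc ∑ i, s i ^ α * Real.exp (-β * E i * (1 - α))
      ≤ ∑ i, (α * s i + (1 - α) * Real.exp (-β * E i)) := by
        refine Finset.sum_le_sum fun i _ => ?_
        rw [Real.exp_mul]
        exact Real.geom_mean_le_arith_mean2_weighted h0 (sub_nonneg.2 h1) (hs i).le
          (Real.exp_pos _).le (by ring)
    _ = α + (1 - α) * ∑ i, Real.exp (-β * E i) := by
        rw [Finset.sum_add_distrib, ← Finset.mul_sum, ← Finset.mul_sum, hssum, mul_one]
    _ ≤ ∑ i, Real.exp (-β * E i) := by
        nlinarith [mul_nonneg h0 (sub_nonneg.2 hZ)]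
end

section
/- Lower bound near the ground state (appendix Lemma 8, classical version): Let m ≥ 1, β > 0, r : Fin m → ℝ a probability vector with r i > 0 for all i, and F : Fin m → ℝ with F i ≥ 0 for all i; set g(α) := Σ_i (r i)^α · Real.exp (−β · (F i) · (1 − α)). Then for every a ∈ (0, 1) there exists ε₀ > 0 such that for all ε with 0 < ε < ε₀ and all α ∈ Set.Icc (0 : ℝ) a, (1 − ε)^α + ε^α · g(α) ≥ 1. -/
theorem f_lower_bound_near_ground_state (m : ℕ) (hm : 1 ≤ m) (β : ℝ) (hβ : 0 < β)
    (r : Fin m → ℝ) (hr : ∀ i, 0 < r i) (hrsum : ∑ i, r i = 1)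
    (F : Fin m → ℝ) (hF : ∀ i, 0 ≤ F i) :
    ∀ a ∈ Set.Ioo (0:ℝ) 1, ∃ ε₀ > (0:ℝ), ∀ ε : ℝ, 0 < ε → ε < ε₀ →
      ∀ α ∈ Set.Icc (0:ℝ) a,
        (1 - ε) ^ α + ε ^ α * (∑ i, r i ^ α * Real.exp (-β * F i * (1 - α))) ≥ 1 := by
  rintro a ⟨ha0, ha1⟩
  let j : Fin m := ⟨0, hm⟩
  have hrj : r j ≤ 1 :=
    hrsum ▸ Finset.single_le_sum (fun i _ => (hr i).le) (Finset.mem_univ j)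
  set c : ℝ := r j * Real.exp (-β * F j)
  have hc0 : 0 < c := mul_pos (hr j) (Real.exp_pos _)
  refine ⟨min 1 (c ^ (1 - a)⁻¹), lt_min one_pos (Real.rpow_pos_of_pos hc0 _), ?_⟩
  rintro ε hε hεlt α ⟨hα0, hαa⟩
  have hε1 : ε < 1 := hεlt.trans_le (min_le_left _ _)
  have hεc : ε < c ^ (1 - a)⁻¹ := hεlt.trans_le (min_le_right _ _)
  have hα1 : α ≤ 1 := hαa.trans ha1.le
  have hground : 1 - ε ≤ (1 - ε) ^ α := by
    simpa using Real.rpow_le_rpow_of_exponent_ge (by linarith : 0 < 1 - ε) (by linarith) hα1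
  have hrpow : r j ≤ r j ^ α := by
    simpa using Real.rpow_le_rpow_of_exponent_ge (hr j) hrj hα1
  have hexp : Real.exp (-β * F j) ≤ Real.exp (-β * F j * (1 - α)) := by
    apply Real.exp_le_exp.mpr
    nlinarith [mul_nonneg (mul_nonneg hβ.le (hF j)) hα0]
  have hg : c ≤ ∑ i, r i ^ α * Real.exp (-β * F i * (1 - α)) :=
    (mul_le_mul hrpow hexp (Real.exp_pos _).le (Real.rpow_nonneg (hr j).le _)).trans
      (Finset.single_le_sum (f := fun i => r i ^ α * Real.exp (-β * F i * (1 - α)))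
        (fun i _ => mul_nonneg (Real.rpow_nonneg (hr i).le _) (Real.exp_pos _).le)
        (Finset.mem_univ j))
  have hεpow : ε ^ (1 - a) ≤ c := by
    have h := Real.rpow_le_rpow hε.le hεc.le (by linarith : 0 ≤ 1 - a)
    rwa [← Real.rpow_mul hc0.le, inv_mul_cancel₀ (by linarith), Real.rpow_one] at h
  have hexcited : ε ≤ ε ^ α * ∑ i, r i ^ α * Real.exp (-β * F i * (1 - α)) :=
    calc ε = ε ^ a * ε ^ (1 - a) := by rw [← Real.rpow_add hε]; simp
      _ ≤ ε ^ α * ∑ i, r i ^ α * Real.exp (-β * F i * (1 - α)) :=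
        mul_le_mul (Real.rpow_le_rpow_of_exponent_ge hε hε1.le hαa) (hεpow.trans hg)
          (Real.rpow_nonneg hε.le _) (Real.rpow_nonneg hε.le _)
  linarith
end
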